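/- Let 0 < D₁ < D₂ < β′ < β and assume (D₁, D₂) ∩ σ(H̃) = ∅. If ‖HΠ‖² (β′)² β⁻³ < (D₂ − D₁)/2, then the open interval (D₁ + ‖HΠ‖² (β′)² β⁻³, D₂ − ‖HΠ‖² (β′)² β⁻³) is disjoint from σ(H). -/

import Mathlib

noncomputable section

open MeasureTheory
open scoped ComplexOrder

/-- The abstract Feshbach–Schur setup: a densely defined nonnegative self-adjoint operator `H`,
an orthogonal projection `P` (denoted `Π`) with range in the domain of `H`, a bounded operator
`T = HΠ`, and a lower bound `Π⊥ H Π⊥ ≥ 2β Π⊥`. -/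
structure FeshbachSetup (ℋ : Type*) [NormedAddCommGroup ℋ] [InnerProductSpace ℂ ℋ]
    [CompleteSpace ℋ] (β : ℝ) : Type _ where
  H : ℋ →ₗ.[ℂ] ℋ
  dense_dom : Dense (H.domain : Set ℋ)
  selfAdjoint : IsSelfAdjoint H
  nonneg : ∀ u : H.domain, 0 ≤ (inner ℂ (u : ℋ) (H u) : ℂ)
  P : ℋ →L[ℂ] ℋ
  P_idem : P.comp P = P
  P_sa : ContinuousLinearMap.adjoint P = P
  memP : ∀ x : ℋ, P x ∈ H.domain
  T : ℋ →L[ℂ] ℋ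
  T_eq : ∀ x : ℋ, T x = H ⟨P x, memP x⟩
  β_pos : 0 < β
  lower : ∀ u : H.domain,
    ((2 * β * ‖(u : ℋ) - P u‖ ^ 2 : ℝ) : ℂ) ≤
      inner ℂ ((u : ℋ) - P u) (H ⟨(u : ℋ) - P u, H.domain.sub_mem u.2 (memP u)⟩)

namespace FeshbachSetup

variable {ℋ : Type*} [NormedAddCommGroup ℋ] [InnerProductSpace ℂ ℋ] [CompleteSpace ℋ]
variable {β : ℝ} (S : FeshbachSetup ℋ β)

/-- `R` witnesses that `H - E` is a bijection from the domain of `H` onto `ℋ`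
with bounded inverse `R`. -/
def IsInvWitness (E : ℝ) (R : ℋ →L[ℂ] ℋ) : Prop :=
  (∀ u : S.H.domain, R (S.H u - (E : ℂ) • (u : ℋ)) = u) ∧
  (∀ y : ℋ, ∃ h : R y ∈ S.H.domain, S.H ⟨R y, h⟩ - (E : ℂ) • R y = y)

/-- `H - E` is a bijection from the domain of `H` onto `ℋ` with bounded inverse. -/
def IsInvertibleAt (E : ℝ) : Prop := ∃ R, S.IsInvWitness E R

/-- the spectrum `σ(H)` (as a subset of `ℝ`). -/
def spec : Set ℝ := {E | ¬ S.IsInvertibleAt E}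

/-- the bounded operator `Π⊥ H Π`. -/
def A : ℋ →L[ℂ] ℋ := (1 - S.P).comp S.T

/-- `R : ℝ → 𝓛(ℋ)` is the family of reduced resolvents `E ↦ R⊥(E)`:  for `E ∈ [0, 2β)`,
`R E` is supported on `Π⊥ℋ` and is there a two-sided inverse of `Π⊥(H - E)Π⊥`. -/
def IsRedResolvent (R : ℝ → (ℋ →L[ℂ] ℋ)) : Prop :=
  ∀ E ∈ Set.Ico (0 : ℝ) (2 * β),
    ((1 - S.P).comp ((R E).comp (1 - S.P)) = R E) ∧
    (∀ u : S.H.domain,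
      R E ((1 - S.P)
          (S.H ⟨(u : ℋ) - S.P u, S.H.domain.sub_mem u.2 (S.memP u)⟩
            - (E : ℂ) • ((u : ℋ) - S.P u)))
        = (u : ℋ) - S.P u) ∧
    (∀ y : ℋ, ∃ h : R E y ∈ S.H.domain,
      (1 - S.P) (S.H ⟨R E y, h⟩ - (E : ℂ) • R E y) = (1 - S.P) y)

/-- `Y = Π + ΠHΠ⊥ R⊥(0)² Π⊥HΠ`, as an operator on `ℋ` vanishing on `Π⊥ℋ`. -/
def Y (R : ℝ → (ℋ →L[ℂ] ℋ)) : ℋ →L[ℂ] ℋ :=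
  S.P + (ContinuousLinearMap.adjoint S.A).comp ((R 0).comp ((R 0).comp S.A))

/-- `G` is `Y^{-1/2} ∈ 𝓛(Πℋ)`, extended by `0` on `Π⊥ℋ`:  `G` is supported on `Πℋ`,
self-adjoint, nonnegative, and `G Y G = Π`. -/
def IsYInvSqrt (R : ℝ → (ℋ →L[ℂ] ℋ)) (G : ℋ →L[ℂ] ℋ) : Prop :=
  S.P.comp (G.comp S.P) = G ∧
  ContinuousLinearMap.adjoint G = G ∧
  (∀ x : ℋ, 0 ≤ (inner ℂ x (G x) : ℂ)) ∧
  G.comp ((S.Y R).comp G) = S.P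

/-- the dressed operator `H̃ = Y^{-1/2}[ΠHΠ - ΠHΠ⊥R⊥(0)Π⊥HΠ]Y^{-1/2}`,
extended by `0` on `Π⊥ℋ`. -/
def Htilde (R : ℝ → (ℋ →L[ℂ] ℋ)) (G : ℋ →L[ℂ] ℋ) : ℋ →L[ℂ] ℋ :=
  G.comp (((S.P.comp S.T) - (ContinuousLinearMap.adjoint S.A).comp ((R 0).comp S.A)).comp G)

end FeshbachSetup

/-- `V` is a two-sided inverse of `W` in the corner algebra `Π 𝓛(ℋ) Π` (with unit `P`),
i.e. `W` viewed as an operator on `Πℋ` is invertible with inverse `V`. -/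
def IsCornerInv {ℋ : Type*} [NormedAddCommGroup ℋ] [InnerProductSpace ℂ ℋ]
    (P W V : ℋ →L[ℂ] ℋ) : Prop :=
  P.comp (V.comp P) = V ∧ V.comp W = P ∧ W.comp V = P

/-- the spectrum of an operator `W` supported on `Πℋ`, viewed as a bounded operator
on `Πℋ` (as a subset of `ℝ`). -/
def cornerSpec {ℋ : Type*} [NormedAddCommGroup ℋ] [InnerProductSpace ℂ ℋ]
    (P W : ℋ →L[ℂ] ℋ) : Set ℝ :=
  {E : ℝ | ¬ ∃ V, IsCornerInv P (W - (E : ℂ) • P) V}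

lemma fs_corner_norm {𝒜 : Type*} [CStarAlgebra 𝒜] (p W V : 𝒜) (d : ℝ) (hd : 0 < d)
    (pV : p * V = V) (Vp : V * p = V) (pp : p * p = p) (Wp : W * p = W) (pW : p * W = W)
    (VW : V * W = p) (WV : W * V = p) (hV : IsSelfAdjoint V)
    (h : ∀ t : ℝ, |t| < d → ∃ U : 𝒜, p * U = U ∧ U * p = U ∧
      U * (W - (t : ℂ) • p) = p ∧ (W - (t : ℂ) • p) * U = p) : ‖V‖ ≤ d⁻¹ := by
  have key : spectralRadius ℂ V ≤ ENNReal.ofReal d⁻¹ := by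
    refine iSup₂_le fun z hz => ?_
    by_contra hlt
    rw [not_le] at hlt
    have hre := hV.mem_spectrum_eq_re hz
    obtain ⟨t, rfl⟩ : ∃ t : ℝ, z = (t : ℂ) := ⟨z.re, hre⟩
    have h1 : d⁻¹ < |t| := by
      have : ENNReal.ofReal d⁻¹ < ENNReal.ofReal |t| := by
        convert hlt using 1
        rw [← Real.norm_eq_abs, ← Complex.norm_real, ofReal_norm]
        rfl
      exact (ENNReal.ofReal_lt_ofReal_iff_of_nonneg (by positivity)).1 this
    have htp : 0 < |t| := lt_trans (by positivity) h1
    have ht0 : t ≠ 0 := abs_pos.1 htp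
    have htc : (t : ℂ) ≠ 0 := by exact_mod_cast ht0
    obtain ⟨U, pU, Up, UW, WU⟩ := h t⁻¹ (by
      rw [abs_inv]; exact inv_lt_of_inv_lt₀ hd h1)
    rw [Complex.ofReal_inv] at UW WU
    apply hz
    rw [spectrum.mem_resolventSet_iff, Algebra.algebraMap_eq_smul_one]
    have e1 : U * W = p + (t : ℂ)⁻¹ • U := by
      rw [mul_sub, mul_smul_comm, Up] at UW
      rw [← UW]; abel
    have e2 : W * U = p + (t : ℂ)⁻¹ • U := by
      rw [sub_mul, smul_mul_assoc, pU] at WU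
      rw [← WU]; abel
    -- inverse of t - V is t⁻¹ (U W + 1 - p)
    have f1 : U * W * V = U := by rw [mul_assoc, WV, Up]
    have f2 : V * (U * W) = U := by
      rw [e1, ← e2, ← mul_assoc, VW, pU]
    have a1 : ((t : ℂ) • (1 : 𝒜) - V) * ((t : ℂ)⁻¹ • (U * W + 1 - p)) = 1 := by
      rw [mul_smul_comm, sub_mul, smul_mul_assoc, one_mul, mul_sub, mul_add, f2, mul_one, Vp, e1]
      simp only [smul_sub, smul_add, smul_smul, mul_inv_cancel₀ htc, inv_mul_cancel₀ htc, one_smul]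
      module
    have a2 : ((t : ℂ)⁻¹ • (U * W + 1 - p)) * ((t : ℂ) • (1 : 𝒜) - V) = 1 := by
      rw [smul_mul_assoc, mul_sub, mul_smul_comm, mul_one, sub_mul, add_mul, f1, one_mul, pV, e1]
      simp only [smul_sub, smul_add, smul_smul, mul_inv_cancel₀ htc, inv_mul_cancel₀ htc, one_smul]
      module
    exact ⟨⟨_, _, a1, a2⟩, rfl⟩
  rw [hV.spectralRadius_eq_nnnorm] at key
  have := ENNReal.toReal_mono ENNReal.ofReal_ne_top key
  rw [ENNReal.toReal_ofReal (by positivity)] at this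
  simpa using this

lemma fs_perturb {𝒜 : Type*} [NormedRing 𝒜] [CompleteSpace 𝒜] (p W V K : 𝒜)
    (pV : p * V = V) (Vp : V * p = V) (Wp : W * p = W)
    (Kp : K * p = K) (pK : p * K = K)
    (VW : V * W = p) (WV : W * V = p) (hlt : ‖V * K‖ < 1) :
    ∃ N : 𝒜, p * N = N ∧ N * p = N ∧ N * (W - K) = p ∧ (W - K) * N = p := by
  obtain ⟨u, hu⟩ : ∃ u : 𝒜ˣ, (u : 𝒜) = 1 - V * K := isUnit_one_sub_of_norm_lt_one hlt
  have hN : (u : 𝒜) * (↑u⁻¹ * V) = V := by rw [← mul_assoc, Units.mul_inv, one_mul]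
  refine ⟨↑u⁻¹ * V, ?_, by rw [mul_assoc, Vp], ?_, ?_⟩
  · set N := ↑u⁻¹ * V
    have : N = V + V * (K * N) := by
      rw [hu, sub_mul, one_mul, mul_assoc] at hN
      exact sub_eq_iff_eq_add.1 hN
    rw [this, mul_add, ← mul_assoc, pV]
  · have : V * (W - K) = u * p := by
      rw [hu, mul_sub, VW, sub_mul, one_mul, mul_assoc, Kp]
    rw [mul_assoc, this, ← mul_assoc, Units.inv_mul, one_mul]
  · have : W - K = W * u := by
      rw [hu, mul_sub, mul_one, ← mul_assoc, WV, pK]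
    rw [this, mul_assoc, hN, WV]

lemma fs_undress {𝒜 : Type*} [Ring 𝒜] (p G Y F N : 𝒜)
    (pG : p * G = G) (Gp : G * p = G) (pY : p * Y = Y) (Yp : Y * p = Y)
    (pF : p * F = F) (Fp : F * p = F) (GYG : G * (Y * G) = p)
    (pN : p * N = N) (h1 : N * (G * F * G) = p) (h2 : (G * F * G) * N = p) :
    ∃ M : 𝒜, p * M = M ∧ M * p = M ∧ M * F = p ∧ F * M = p := by
  have hL : G * Y = Y * G := by
    calc G * Y = G * (Y * p) := by rw [Yp]
      _ = G * (Y * (G * (Y * G))) := by rw [GYG]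
      _ = (G * (Y * G)) * (Y * G) := by simp only [mul_assoc]
      _ = Y * G := by rw [GYG, ← mul_assoc, pY]
  have LG : (G * Y) * G = p := by rw [mul_assoc, GYG]
  have hGL : G * (G * Y) = p := by rw [hL, GYG]
  refine ⟨G * N * G, by rw [← mul_assoc, ← mul_assoc, pG], by rw [mul_assoc, Gp], ?_, ?_⟩
  · calc G * N * G * F = G * N * G * (F * p) := by rw [Fp]
      _ = G * N * G * (F * (G * (G * Y))) := by rw [hGL]
      _ = G * (N * (G * F * G)) * (G * Y) := by simp only [mul_assoc]
      _ = p := by rw [h1, Gp, hGL]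
  · calc F * (G * N * G) = p * F * (G * N * G) := by rw [pF]
      _ = (G * Y) * G * F * (G * N * G) := by rw [LG]
      _ = (G * Y) * ((G * F * G) * N) * G := by simp only [mul_assoc]
      _ = p := by rw [h2, mul_assoc G Y p, Yp, LG]

namespace FeshbachSetup

variable {ℋ : Type*} [NormedAddCommGroup ℋ] [InnerProductSpace ℂ ℋ] [CompleteSpace ℋ]
variable {β : ℝ} (S : FeshbachSetup ℋ β)

lemma fs_symm (u v : S.H.domain) :
    (inner ℂ (S.H u) (v : ℋ) : ℂ) = inner ℂ (u : ℋ) (S.H v) := by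
  have h := LinearPMap.adjoint_isFormalAdjoint (T := S.H) S.dense_dom
  have e : S.H.adjoint = S.H := S.selfAdjoint
  rw [e] at h
  exact h u v

lemma fs_PP : S.P * S.P = S.P := S.P_idem

lemma fs_P_inner (x y : ℋ) : (inner ℂ (S.P x) y : ℂ) = inner ℂ x (S.P y) := by
  rw [← ContinuousLinearMap.adjoint_inner_right, S.P_sa]

lemma fs_PPx (x : ℋ) : S.P (S.P x) = S.P x := DFunLike.congr_fun S.P_idem x

lemma fs_TP : S.T * S.P = S.T := by
  ext x
  change S.T (S.P x) = S.T x
  rw [S.T_eq, S.T_eq]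
  congr 1
  exact Subtype.ext (S.fs_PPx x)

lemma fs_AP : S.A * S.P = S.A := by
  change (1 - S.P) * S.T * S.P = (1 - S.P) * S.T
  rw [mul_assoc, S.fs_TP]

lemma fs_PA : S.P * S.A = 0 := by
  change S.P * ((1 - S.P) * S.T) = 0
  rw [← mul_assoc, mul_sub, mul_one, S.fs_PP, sub_self, zero_mul]

lemma fs_starP : star S.P = S.P := S.P_sa

lemma fs_PAs : S.P * star S.A = star S.A := by
  have := congrArg star S.fs_AP
  rwa [star_mul, S.fs_starP] at this

lemma fs_P_le (x : ℋ) : ‖S.P x‖ ≤ ‖x‖ := by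
  have h : ‖S.P x‖ ^ 2 = RCLike.re (inner ℂ x (S.P x) : ℂ) := by
    rw [← S.fs_PPx x, ← S.fs_P_inner, inner_self_eq_norm_sq, S.fs_PPx]
  have h2 := re_inner_le_norm (𝕜 := ℂ) x (S.P x)
  nlinarith [norm_nonneg (S.P x), norm_nonneg x]

lemma fs_Pp_le (x : ℋ) : ‖x - S.P x‖ ≤ ‖x‖ := by
  have h : ‖x - S.P x‖ ^ 2 = RCLike.re (inner ℂ x (x - S.P x) : ℂ) := by
    rw [← inner_self_eq_norm_sq (𝕜 := ℂ), inner_sub_left, S.fs_P_inner, map_sub S.P, S.fs_PPx, sub_self,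
      inner_zero_right, sub_zero]
  have h2 := re_inner_le_norm (𝕜 := ℂ) x (x - S.P x)
  nlinarith [norm_nonneg (x - S.P x), norm_nonneg x]

lemma fs_A_le : ‖S.A‖ ≤ ‖S.T‖ := by
  refine ContinuousLinearMap.opNorm_le_bound _ (norm_nonneg _) fun x => ?_
  exact (S.fs_Pp_le (S.T x)).trans (S.T.le_opNorm x)

lemma fs_PT_star : star (S.P * S.T) = S.P * S.T := by
  change ContinuousLinearMap.adjoint (S.P * S.T) = S.P * S.T
  symm
  rw [ContinuousLinearMap.eq_adjoint_iff]
  intro x y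
  change inner ℂ (S.P (S.T x)) y = inner ℂ x (S.P (S.T y))
  rw [S.fs_P_inner (S.T x), ← S.fs_P_inner x, S.T_eq, S.T_eq]
  exact S.fs_symm ⟨S.P x, S.memP x⟩ ⟨S.P y, S.memP y⟩

/-- `Π H q = A* q` for `q` in the domain with `Π q = 0`. -/
lemma fs_PH (q : S.H.domain) (hq : S.P q = 0) : S.P (S.H q) = (star S.A) (q : ℋ) := by
  refine ext_inner_right ℂ fun x => ?_
  change _ = inner ℂ (ContinuousLinearMap.adjoint S.A (q : ℋ)) x
  rw [ContinuousLinearMap.adjoint_inner_left]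
  change _ = inner ℂ (q : ℋ) (S.T x - S.P (S.T x))
  rw [inner_sub_right, ← S.fs_P_inner (q : ℋ), hq, inner_zero_left, sub_zero, S.T_eq, S.fs_P_inner]
  exact S.fs_symm q ⟨S.P x, S.memP x⟩

variable {S} {R : ℝ → (ℋ →L[ℂ] ℋ)} (hR : S.IsRedResolvent R)
include hR

lemma fs_PR {E : ℝ} (hE : E ∈ Set.Ico (0 : ℝ) (2 * β)) : S.P * R E = 0 := by
  have h : (1 - S.P) * (R E * (1 - S.P)) = R E := (hR E hE).1
  rw [← h, ← mul_assoc, mul_sub, mul_one, S.fs_PP, sub_self, zero_mul]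

lemma fs_RP {E : ℝ} (hE : E ∈ Set.Ico (0 : ℝ) (2 * β)) : R E * S.P = 0 := by
  have h : (1 - S.P) * (R E * (1 - S.P)) = R E := (hR E hE).1
  rw [← h, mul_assoc, mul_assoc, sub_mul 1 S.P S.P, one_mul, S.fs_PP, sub_self, mul_zero, mul_zero]

lemma fs_PRx {E : ℝ} (hE : E ∈ Set.Ico (0 : ℝ) (2 * β)) (x : ℋ) : S.P (R E x) = 0 :=
  DFunLike.congr_fun (fs_PR hR hE) x

lemma fs_RPx {E : ℝ} (hE : E ∈ Set.Ico (0 : ℝ) (2 * β)) (x : ℋ) : R E (S.P x) = 0 :=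
  DFunLike.congr_fun (fs_RP hR hE) x

lemma fs_dom {E : ℝ} (hE : E ∈ Set.Ico (0 : ℝ) (2 * β)) (y : ℋ) : R E y ∈ S.H.domain :=
  ((hR E hE).2.2 y).1

lemma fs_HR {E : ℝ} (hE : E ∈ Set.Ico (0 : ℝ) (2 * β)) (y : ℋ) :
    S.H ⟨R E y, fs_dom hR hE y⟩ - S.P (S.H ⟨R E y, fs_dom hR hE y⟩)
      = y - S.P y + (E : ℂ) • R E y := by
  obtain ⟨h, e⟩ := (hR E hE).2.2 y
  change S.H ⟨R E y, h⟩ - (E : ℂ) • R E y - S.P (S.H ⟨R E y, h⟩ - (E : ℂ) • R E y) = y - S.P y at e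
  rw [map_sub, map_smul, fs_PRx hR hE, smul_zero, sub_zero] at e
  rw [← e]; abel

/-- `R_E' ((H q)⊥ - E' q) = q`. -/
lemma fs_RH {E : ℝ} (hE : E ∈ Set.Ico (0 : ℝ) (2 * β)) (q : S.H.domain) (hq : S.P q = 0) :
    R E (S.H q - S.P (S.H q) - (E : ℂ) • (q : ℋ)) = q := by
  have e := (hR E hE).2.1 q
  have hz : (⟨(q : ℋ) - S.P q, S.H.domain.sub_mem q.2 (S.memP q)⟩ : S.H.domain) = q :=
    Subtype.ext (by simp [hq])
  rw [hz, hq, sub_zero] at e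
  change R E (S.H q - (E : ℂ) • (q : ℋ) - S.P (S.H q - (E : ℂ) • (q : ℋ))) = q at e
  rw [map_sub S.P, map_smul, hq, smul_zero, sub_zero] at e
  rw [sub_right_comm]
  exact e

lemma fs_res {E E' : ℝ} (hE : E ∈ Set.Ico (0 : ℝ) (2 * β)) (hE' : E' ∈ Set.Ico (0 : ℝ) (2 * β)) :
    R E = R E' + ((E : ℂ) - E') • (R E' * R E) := by
  ext y
  have h := fs_RH hR hE' ⟨R E y, fs_dom hR hE y⟩ (fs_PRx hR hE y)
  rw [fs_HR hR hE y] at h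
  simp only [map_add, map_sub, map_smul, fs_RPx hR hE'] at h
  change R E y = R E' y + ((E : ℂ) - E') • (R E' (R E y))
  rw [sub_smul]
  nth_rewrite 1 [← h]
  abel

lemma fs_R_norm {E : ℝ} (hE0 : 0 ≤ E) (hE : E ≤ β) : ‖R E‖ ≤ β⁻¹ := by
  have hβ := S.β_pos
  have hm : E ∈ Set.Ico (0 : ℝ) (2 * β) := ⟨hE0, by linarith⟩
  refine ContinuousLinearMap.opNorm_le_bound _ (by positivity) fun y => ?_
  have hl := S.lower ⟨R E y, fs_dom hR hm y⟩
  have hz : (⟨R E y - S.P (R E y), S.H.domain.sub_mem (fs_dom hR hm y) (S.memP (R E y))⟩ :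
      S.H.domain) = ⟨R E y, fs_dom hR hm y⟩ := Subtype.ext (by simp [fs_PRx hR hm])
  simp only [hz, fs_PRx hR hm, sub_zero] at hl
  have h0 : (inner ℂ (R E y) (S.P (S.H ⟨R E y, fs_dom hR hm y⟩)) : ℂ) = 0 := by
    rw [← S.fs_P_inner, fs_PRx hR hm, inner_zero_left]
  have h1 : (inner ℂ (R E y) (S.H ⟨R E y, fs_dom hR hm y⟩) : ℂ)
      = inner ℂ (R E y) y + (E : ℂ) * inner ℂ (R E y) (R E y) := by
    have h2 := congrArg (fun z => (inner ℂ (R E y) z : ℂ)) (fs_HR hR hm y)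
    simp only [inner_sub_right, inner_add_right, inner_smul_right, h0, sub_zero] at h2
    rw [h2, ← S.fs_P_inner, fs_PRx hR hm, inner_zero_left, sub_zero]
  rw [h1, inner_self_eq_norm_sq_to_K] at hl
  have h3 := (Complex.le_def.1 hl).1
  have h4 : (inner ℂ (R E y) y : ℂ).re ≤ ‖R E y‖ * ‖y‖ := re_inner_le_norm (𝕜 := ℂ) _ _
  have h5 : ((E : ℂ) * ((‖R E y‖ : ℝ) : ℂ) ^ 2).re = E * ‖R E y‖ ^ 2 := by
    norm_cast
  have h6 : 2 * β * ‖R E y‖ ^ 2 ≤ ‖R E y‖ * ‖y‖ + E * ‖R E y‖ ^ 2 := by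
    rw [← h5]
    refine le_trans ?_ (add_le_add_left h4 _)
    rw [← Complex.add_re]
    rw [Complex.ofReal_re] at h3
    exact h3
  rw [inv_mul_eq_div, le_div_iff₀ hβ]
  by_contra hc
  rw [not_le] at hc
  have hq : 0 < ‖R E y‖ := by
    by_contra h
    have : ‖R E y‖ = 0 := le_antisymm (not_lt.1 h) (norm_nonneg _)
    rw [this] at hc
    linarith [norm_nonneg y]
  nlinarith [mul_pos hq (sub_pos.2 hc), mul_nonneg (sub_nonneg.2 hE) (sq_nonneg ‖R E y‖)]

lemma fs_zero_mem : (0 : ℝ) ∈ Set.Ico (0 : ℝ) (2 * β) := ⟨le_rfl, by linarith [S.β_pos]⟩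

lemma fs_R0_star : star (R 0) = R 0 := by
  have hm := fs_zero_mem hR
  change ContinuousLinearMap.adjoint (R 0) = R 0
  symm
  rw [ContinuousLinearMap.eq_adjoint_iff]
  have key : ∀ x y : ℋ, (inner ℂ (R 0 x) y : ℂ)
      = inner ℂ (R 0 x) (S.H ⟨R 0 y, fs_dom hR hm y⟩) := by
    intro x y
    have h2 := congrArg (fun z => (inner ℂ (R 0 x) z : ℂ)) (fs_HR hR hm y)
    simp only [inner_sub_right, inner_add_right, inner_smul_right, ← S.fs_P_inner,
      fs_PRx hR hm, inner_zero_left, sub_zero] at h2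
    rw [h2]; simp
  intro x y
  rw [key x y, ← inner_conj_symm x, key y x, inner_conj_symm]
  exact (S.fs_symm ⟨R 0 x, fs_dom hR hm x⟩ ⟨R 0 y, fs_dom hR hm y⟩).symm

/-- the Schur complement -/
lemma fs_schur {E : ℝ} (hE : E ∈ Set.Ico (0 : ℝ) (2 * β)) (M : ℋ →L[ℂ] ℋ)
    (pM : S.P * M = M)
    (hM : (S.P * S.T - (E : ℂ) • S.P - star S.A * (R E * S.A)) * M = S.P) :
    S.IsInvertibleAt E := by
  set B : ℋ →L[ℂ] ℋ := M * (1 - star S.A * R E) with hB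
  have surj : ∀ y : ℋ, ∃ h : (B + R E * (1 - S.A * B)) y ∈ S.H.domain,
      S.H ⟨(B + R E * (1 - S.A * B)) y, h⟩ - (E : ℂ) • (B + R E * (1 - S.A * B)) y = y := by
    intro y
    set p := B y with hp
    set q := R E (y - S.A p) with hq
    have hPp : S.P p = p := by
      have : S.P * B = B := by rw [hB, ← mul_assoc, pM]
      exact DFunLike.congr_fun this y
    have hpd : p ∈ S.H.domain := by rw [← hPp]; exact S.memP p
    have hqd : q ∈ S.H.domain := fs_dom hR hE _
    have hPq : S.P q = 0 := fs_PRx hR hE _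
    have hval : (B + R E * (1 - S.A * B)) y = p + q := rfl
    have hsum : S.H ⟨p + q, S.H.domain.add_mem hpd hqd⟩ = S.T p + S.H ⟨q, hqd⟩ := by
      have : (⟨p + q, S.H.domain.add_mem hpd hqd⟩ : S.H.domain) = ⟨p, hpd⟩ + ⟨q, hqd⟩ := rfl
      rw [this, LinearPMap.map_add, S.T_eq]
      congr 2
      exact Subtype.ext hPp.symm
    have hAp : S.A p = S.T p - S.P (S.T p) := rfl
    have hHq := fs_HR hR hE (y - S.A p)
    have hPA : S.P (S.A p) = 0 := DFunLike.congr_fun S.fs_PA p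
    have hPH := S.fs_PH ⟨q, hqd⟩ hPq
    have hMy := DFunLike.congr_fun hM (y - star S.A (R E y))
    change S.P (S.T p) - (E : ℂ) • S.P p - star S.A (R E (S.A p))
      = S.P (y - star S.A (R E y)) at hMy
    have hPAs : S.P (star S.A (R E y)) = star S.A (R E y) := DFunLike.congr_fun S.fs_PAs _
    rw [map_sub, hPAs, hPp] at hMy
    change S.H ⟨q, hqd⟩ - S.P (S.H ⟨q, hqd⟩) = y - S.A p - S.P (y - S.A p) + (E : ℂ) • q at hHq
    rw [map_sub, hPA, sub_zero] at hHq
    change S.P (S.H ⟨q, hqd⟩) = star S.A q at hPH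
    rw [hPH] at hHq
    have hAq : star S.A q = star S.A (R E y) - star S.A (R E (S.A p)) := by
      rw [hq, map_sub, map_sub]
    refine ⟨by rw [hval]; exact S.H.domain.add_mem hpd hqd, ?_⟩
    change S.H ⟨p + q, S.H.domain.add_mem hpd hqd⟩ - (E : ℂ) • (p + q) = y
    rw [hsum, smul_add]
    have e1 : S.H ⟨q, hqd⟩ = y - S.A p - S.P y + (E : ℂ) • q + star S.A q := by
      rw [← hHq]; abel
    have e2 : S.P (S.T p) = S.P y - star S.A (R E y) + (E : ℂ) • p + star S.A (R E (S.A p)) := by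
      rw [← hMy]; abel
    have e3 : S.T p = S.A p + S.P (S.T p) := by rw [hAp]; abel
    rw [e1, hAq]
    nth_rewrite 1 [e3]
    rw [e2]
    abel
  refine ⟨B + R E * (1 - S.A * B), ?_, surj⟩
  intro u
  set Q := B + R E * (1 - S.A * B)
  obtain ⟨h, e⟩ := surj (S.H u - (E : ℂ) • (u : ℋ))
  set z := Q (S.H u - (E : ℂ) • (u : ℋ))
  have hw : S.H (⟨z, h⟩ - u) = (E : ℂ) • (z - (u : ℋ)) := by
    rw [LinearPMap.map_sub, smul_sub]
    rw [sub_eq_sub_iff_add_eq_add] at e ⊢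
    rw [add_comm ((E : ℂ) • z), e]
  obtain ⟨h', e'⟩ := surj (z - u)
  have hs := S.fs_symm (⟨z, h⟩ - u) ⟨Q (z - u), h'⟩
  rw [hw] at hs
  have h0 : (inner ℂ (z - (u : ℋ)) (z - (u : ℋ)) : ℂ) = 0 := by
    nth_rewrite 2 [← e']
    rw [inner_sub_right, inner_smul_right]
    change inner ℂ ((E : ℂ) • (z - (u : ℋ))) (Q (z - u)) = inner ℂ (z - (u : ℋ)) (S.H ⟨Q (z - u), h'⟩) at hs
    rw [← hs, inner_smul_left, Complex.conj_ofReal, sub_self]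
  exact sub_eq_zero.1 (inner_self_eq_zero.1 h0)

lemma fs_G_norm {G : ℋ →L[ℂ] ℋ} (hG : S.IsYInvSqrt R G) : ‖G‖ ≤ 1 := by
  obtain ⟨g1, g2, -, g4⟩ := hG
  have pG : S.P * G = G := by
    have : S.P * (G * S.P) = G := g1
    rw [← this, ← mul_assoc, S.fs_PP]
  have hRs : ContinuousLinearMap.adjoint (R 0) = R 0 := fs_R0_star hR
  refine ContinuousLinearMap.opNorm_le_bound _ zero_le_one fun x => ?_
  have h := congrArg (fun z => (inner ℂ x z : ℂ)) (DFunLike.congr_fun g4 x)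
  change inner ℂ x (G (S.P (G x) + ContinuousLinearMap.adjoint S.A (R 0 (R 0 (S.A (G x))))))
    = inner ℂ x (S.P x) at h
  have pGx : S.P (G x) = G x := DFunLike.congr_fun pG x
  rw [pGx, ← g2, ContinuousLinearMap.adjoint_inner_right, g2, inner_add_right,
    ContinuousLinearMap.adjoint_inner_right] at h
  have hh : (inner ℂ (S.A (G x)) (R 0 (R 0 (S.A (G x)))) : ℂ)
      = inner ℂ (R 0 (S.A (G x))) (R 0 (S.A (G x))) := by
    rw [← ContinuousLinearMap.adjoint_inner_right (R 0), hRs]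
  rw [hh] at h
  have h1 := congrArg Complex.re h
  rw [Complex.add_re] at h1
  have a1 : (inner ℂ (G x) (G x) : ℂ).re = ‖G x‖ ^ 2 := inner_self_eq_norm_sq (𝕜 := ℂ) _
  have a2 : (inner ℂ (R 0 (S.A (G x))) (R 0 (S.A (G x))) : ℂ).re = ‖R 0 (S.A (G x))‖ ^ 2 :=
    inner_self_eq_norm_sq (𝕜 := ℂ) _
  have a3 : (inner ℂ x (S.P x) : ℂ).re ≤ ‖x‖ * ‖S.P x‖ := re_inner_le_norm (𝕜 := ℂ) _ _
  have a4 := S.fs_P_le x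
  rw [one_mul]
  refine (fun h k => (sq_le_sq₀ (norm_nonneg _) k).1 h) ?_ (norm_nonneg _)
  nlinarith [sq_nonneg ‖R 0 (S.A (G x))‖, norm_nonneg x]

end FeshbachSetup

open FeshbachSetup

/-- If `0 < D₁ < D₂ < β' < β`, `(D₁, D₂)` is disjoint from `σ(H̃)`, and
`‖HΠ‖² (β')² β⁻³ < (D₂ - D₁)/2`, then the interval
`(D₁ + ‖HΠ‖² (β')² β⁻³, D₂ - ‖HΠ‖² (β')² β⁻³)` is disjoint from `σ(H)`. -/
theorem gap_in_spec {ℋ : Type*} [NormedAddCommGroup ℋ] [InnerProductSpace ℂ ℋ]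
    [CompleteSpace ℋ] {β : ℝ} (S : FeshbachSetup ℋ β)
    (R : ℝ → (ℋ →L[ℂ] ℋ)) (hR : S.IsRedResolvent R)
    (G : ℋ →L[ℂ] ℋ) (hG : S.IsYInvSqrt R G)
    {β' D₁ D₂ : ℝ} (hD₁ : 0 < D₁) (h₁₂ : D₁ < D₂) (hD₂ : D₂ < β') (hβ' : β' < β)
    (hgap : Set.Ioo D₁ D₂ ∩ cornerSpec S.P (S.Htilde R G) = ∅)
    (hsmall : ‖S.T‖ ^ 2 * β' ^ 2 * (β ^ 3)⁻¹ < (D₂ - D₁) / 2) :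
    Set.Ioo (D₁ + ‖S.T‖ ^ 2 * β' ^ 2 * (β ^ 3)⁻¹)
        (D₂ - ‖S.T‖ ^ 2 * β' ^ 2 * (β ^ 3)⁻¹) ∩ S.spec = ∅ := by
  rw [Set.eq_empty_iff_forall_notMem]
  rintro E ⟨⟨hE1, hE2⟩, hsp⟩
  apply hsp
  set δ := ‖S.T‖ ^ 2 * β' ^ 2 * (β ^ 3)⁻¹ with hδ
  have hβ := S.β_pos
  have hδ0 : 0 ≤ δ := by positivity
  have hE : E ∈ Set.Ico (0 : ℝ) (2 * β) := ⟨by linarith, by linarith⟩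
  have hm := fs_zero_mem hR
  have hgn := fs_G_norm hR hG
  obtain ⟨g1, g2, -, g4⟩ := hG
  have g1' : S.P * (G * S.P) = G := g1
  have pG : S.P * G = G := by
    rw [← g1', ← mul_assoc, S.fs_PP]
  have Gp : G * S.P = G := by
    rw [← g1', mul_assoc, mul_assoc, S.fs_PP]
  have gs : star G = G := g2
  have PP := S.fs_PP
  have AP := S.fs_AP
  have PAs := S.fs_PAs
  set F0 : ℋ →L[ℂ] ℋ := S.P * S.T - star S.A * (R 0 * S.A) with hF0
  have hHt : S.Htilde R G = G * (F0 * G) := rfl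
  have hF0s : star F0 = F0 := by
    rw [hF0, star_sub, S.fs_PT_star, star_mul, star_mul, star_star, fs_R0_star hR, mul_assoc]
  set W : ℋ →L[ℂ] ℋ := S.Htilde R G - (E : ℂ) • S.P with hW
  have pHt : S.P * S.Htilde R G = S.Htilde R G := by rw [hHt, ← mul_assoc, pG]
  have Htp : S.Htilde R G * S.P = S.Htilde R G := by rw [hHt, mul_assoc, mul_assoc, Gp]
  have Ws : star W = W := by
    rw [hW, star_sub, hHt, star_mul, star_mul, hF0s, gs, star_smul, S.fs_starP, mul_assoc]
    simp
  have pW : S.P * W = W := by rw [hW, mul_sub, pHt, mul_smul_comm, PP]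
  have Wp : W * S.P = W := by rw [hW, sub_mul, Htp, smul_mul_assoc, PP]
  have hex : ∀ t : ℝ, t ∈ Set.Ioo D₁ D₂ → ∃ V : ℋ →L[ℂ] ℋ, S.P * V = V ∧ V * S.P = V ∧
      V * (S.Htilde R G - (t : ℂ) • S.P) = S.P ∧ (S.Htilde R G - (t : ℂ) • S.P) * V = S.P := by
    intro t ht
    have hn : t ∉ cornerSpec S.P (S.Htilde R G) := fun h =>
      (Set.eq_empty_iff_forall_notMem.1 hgap) t ⟨ht, h⟩
    obtain ⟨V, v1, v2, v3⟩ := not_not.1 hn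
    have v1' : S.P * (V * S.P) = V := v1
    exact ⟨V, by rw [← v1', ← mul_assoc, PP], by rw [← v1', mul_assoc, mul_assoc, PP], v2, v3⟩
  obtain ⟨V, pV, Vp, VW, WV⟩ := hex E ⟨by linarith, by linarith⟩
  have hVs : star V = V := by
    have hs : star V * W = S.P := by
      have := congrArg star WV
      rwa [star_mul, S.fs_starP, Ws] at this
    have hsp' : star V * S.P = star V := by
      have := congrArg star pV
      rwa [star_mul, S.fs_starP] at this
    calc star V = star V * (W * V) := by rw [WV, hsp']
      _ = V := by rw [← mul_assoc, hs, pV]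
  set d := min (E - D₁) (D₂ - E) with hd
  have hδd : δ < d := lt_min (by linarith) (by linarith)
  have hd0 : 0 < d := hδ0.trans_lt hδd
  have hVn : ‖V‖ ≤ d⁻¹ := by
    refine fs_corner_norm S.P W V d hd0 pV Vp PP Wp pW VW WV hVs fun t ht => ?_
    have h1 := (lt_min_iff.1 ht).1
    have h2 := (lt_min_iff.1 ht).2
    rw [abs_lt] at h1 h2
    obtain ⟨U, u1, u2, u3, u4⟩ := hex (E + t) ⟨by linarith, by linarith⟩
    have e : S.Htilde R G - ((E + t : ℝ) : ℂ) • S.P = W - (t : ℂ) • S.P := by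
      rw [hW]; push_cast; module
    rw [e] at u3 u4
    exact ⟨U, u1, u2, u3, u4⟩
  set K : ℋ →L[ℂ] ℋ := ((E : ℂ) ^ 2) • (G * (star S.A * (R 0 * (R E * (R 0 * (S.A * G)))))) with hK
  have pK : S.P * K = K := by rw [hK, mul_smul_comm, ← mul_assoc, pG]
  have Kp : K * S.P = K := by rw [hK, smul_mul_assoc]; simp only [mul_assoc, Gp]
  have hKn : ‖K‖ ≤ δ := by
    have r0 := fs_R_norm hR le_rfl hβ.le
    have rE := fs_R_norm hR hE.1 (by linarith : E ≤ β)
    have hA := S.fs_A_le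
    have hAs : ‖star S.A‖ ≤ ‖S.T‖ := by rw [norm_star]; exact hA
    have hEE : ‖((E : ℂ) ^ 2)‖ ≤ β' ^ 2 := by
      rw [norm_pow, Complex.norm_real, Real.norm_eq_abs, abs_of_nonneg hE.1]
      exact pow_le_pow_left₀ hE.1 (by linarith) 2
    have hb : 0 ≤ β⁻¹ := by positivity
    have mm : ∀ (x y : ℋ →L[ℂ] ℋ) (a b : ℝ), 0 ≤ a → ‖x‖ ≤ a → ‖y‖ ≤ b → ‖x * y‖ ≤ a * b :=
      fun x y a b ha hx hy => (norm_mul_le x y).trans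
        (mul_le_mul hx hy (norm_nonneg _) ha)
    have := mm _ _ _ _ zero_le_one hgn (mm _ _ _ _ (norm_nonneg _) hAs (mm _ _ _ _ hb r0
      (mm _ _ _ _ hb rE (mm _ _ _ _ hb r0 (mm _ _ _ _ (norm_nonneg _) hA hgn)))))
    rw [hK, norm_smul]
    refine (mul_le_mul hEE this (norm_nonneg _) (by positivity)).trans (le_of_eq ?_)
    rw [hδ]; field_simp
  have hlt : ‖V * K‖ < 1 := by
    refine (norm_mul_le _ _).trans_lt ?_
    calc ‖V‖ * ‖K‖ ≤ d⁻¹ * δ := mul_le_mul hVn hKn (norm_nonneg _) (by positivity)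
      _ < 1 := by rw [inv_mul_eq_div, div_lt_one hd0]; exact hδd
  obtain ⟨N, pN, Np, N1, N2⟩ := fs_perturb S.P W V K pV Vp Wp Kp pK VW WV hlt
  set F : ℋ →L[ℂ] ℋ := S.P * S.T - (E : ℂ) • S.P - star S.A * (R E * S.A) with hF
  have hYdef : S.Y R = S.P + star S.A * (R 0 * (R 0 * S.A)) := rfl
  have pY : S.P * S.Y R = S.Y R := by rw [hYdef, mul_add, PP, ← mul_assoc, PAs]
  have Yp : S.Y R * S.P = S.Y R := by
    rw [hYdef, add_mul, PP]; simp only [mul_assoc, AP]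
  have GYG : G * (S.Y R * G) = S.P := g4
  have pF : S.P * F = F := by
    rw [hF, mul_sub, mul_sub, ← mul_assoc, ← mul_assoc, PAs, mul_smul_comm, PP]
  have Fp : F * S.P = F := by
    rw [hF, sub_mul, sub_mul, smul_mul_assoc, PP]; simp only [mul_assoc, AP, S.fs_TP]
  have hres : R E = R 0 + (E : ℂ) • (R 0 * R 0) + ((E : ℂ) ^ 2) • (R 0 * (R E * R 0)) := by
    have e1 := fs_res hR hE hm
    have e2 := fs_res hR hm hE
    simp only [Complex.ofReal_zero, sub_zero, zero_sub] at e1 e2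
    have e3 : R E = R 0 + (E : ℂ) • (R E * R 0) := by
      calc R E = (R E + -(E : ℂ) • (R E * R 0)) + (E : ℂ) • (R E * R 0) := by module
        _ = _ := by rw [← e2]
    calc R E = R 0 + (E : ℂ) • (R 0 * (R 0 + (E : ℂ) • (R E * R 0))) := by rw [← e3]; exact e1
      _ = _ := by rw [mul_add, mul_smul_comm]; module
  have hGFG : G * F * G = W - K := by
    have hFe : F = F0 - (E : ℂ) • S.Y R
        - ((E : ℂ) ^ 2) • (star S.A * (R 0 * (R E * (R 0 * S.A)))) := by
      rw [hF, hF0, hYdef]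
      nth_rewrite 1 [hres]
      simp only [add_mul, mul_add, smul_mul_assoc, mul_smul_comm, mul_assoc]
      module
    rw [hFe, hW, hK, hHt, ← GYG]
    simp only [mul_sub, sub_mul, smul_mul_assoc, mul_smul_comm, mul_assoc]
  rw [← hGFG] at N1 N2
  obtain ⟨M, pM, -, -, M2⟩ := fs_undress S.P G (S.Y R) F N pG Gp pY Yp pF Fp GYG pN N1 N2
  exact fs_schur hR hE M pM M2
end
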